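/- Let ℓ, k ≥ 1 be integers, and let β > 1/2 and s ≥ 0 be reals. Let Λ be a random variable on [ℓ]^k with blockwise min-entropy at least β, and let Γ be a random variable on ({−1,+1}^ℓ)^k with deficiency at most s, i.e. Pr[Γ = y] ≤ 2^{s − ℓk} for every y. Then for every subset I ⊆ [k], sampling x ∼ Λ and y ∼ Γ independently, |E[∏_{i∈I} y_i(x_i)]| ≤ (2^{−β/2 − 1}·(k + s))^{|I|}. -/

import Mathlib

open Finset

/-- The sign `(-1)^b` attached to a bit `b`. -/
noncomputable def boolSign (b : Bool) : ℝ := if b then -1 else 1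

lemma boolSign_not (b : Bool) : boolSign (!b) = -boolSign b := by
  cases b <;> simp [boolSign]

lemma boolSign_xor (a b : Bool) : boolSign (xor a b) = boolSign b * boolSign a := by
  cases a <;> cases b <;> simp [boolSign]

lemma boolSign_sq (b : Bool) : boolSign b ^ 2 = 1 := by
  cases b <;> simp [boolSign]

/-- The `2m`-th moment of a standard Gaussian, i.e. `(2m-1)!!`. -/
noncomputable def gaussMoment (m : ℕ) : ℝ := (2 * m).factorial / (2 ^ m * m.factorial)

lemma gaussMoment_pos (m : ℕ) : 0 < gaussMoment m := by
  unfold gaussMoment; positivity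

lemma one_le_gaussMoment (m : ℕ) : 1 ≤ gaussMoment m := by
  unfold gaussMoment
  rw [one_le_div (by positivity)]
  exact_mod_cast Nat.two_pow_mul_factorial_le_factorial_two_mul m

lemma gaussMoment_le (m : ℕ) : gaussMoment m ≤ (m : ℝ) ^ m := by
  unfold gaussMoment
  rw [div_le_iff₀ (by positivity)]
  have h := Nat.descFactorial_le_pow (2 * m) m
  have h2 := Nat.factorial_mul_descFactorial (n := 2 * m) (k := m) (by omega)
  rw [show 2 * m - m = m by omega] at h2
  have h3 : (2 * m).factorial ≤ m ^ m * (2 ^ m * m.factorial) := by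
    calc (2 * m).factorial = m.factorial * (2 * m).descFactorial m := h2.symm
      _ ≤ m.factorial * (2 * m) ^ m := Nat.mul_le_mul_left _ h
      _ = _ := by rw [mul_pow]; ring
  exact_mod_cast h3

lemma choose_mul_gaussMoment_le {m j : ℕ} (hj : j ≤ m) :
    ((2 * m).choose (2 * j) : ℝ) * gaussMoment j ≤ gaussMoment m * m.choose j := by
  have key : ((2 * m).choose (2 * j) : ℝ) * gaussMoment j * gaussMoment (m - j)
      = gaussMoment m * m.choose j := by
    rw [Nat.cast_choose ℝ hj, Nat.cast_choose ℝ (show 2 * j ≤ 2 * m by omega)]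
    unfold gaussMoment
    rw [show 2 * m - 2 * j = 2 * (m - j) by omega]
    have : (2 : ℝ) ^ m = 2 ^ j * 2 ^ (m - j) := by rw [← pow_add]; congr 1; omega
    rw [this]
    field_simp
  rw [← key]
  exact le_mul_of_one_le_right (by have := gaussMoment_pos j; positivity) (one_le_gaussMoment _)

lemma sum_range_two_mul_add_one (g : ℕ → ℝ) (n : ℕ) :
    ∑ i ∈ range (2 * n + 1), g i
      = ∑ j ∈ range (n + 1), g (2 * j) + ∑ j ∈ range n, g (2 * j + 1) := by
  induction n with
  | zero => simp
  | succ n ih =>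
    rw [show 2 * (n + 1) + 1 = 2 * n + 1 + 1 + 1 by ring, sum_range_succ, sum_range_succ, ih,
      sum_range_succ _ (n + 1), sum_range_succ (fun j => g (2 * j + 1)) n,
      show 2 * (n + 1) = 2 * n + 1 + 1 by ring]
    ring

lemma add_pow_add_sub_pow (x y : ℝ) (m : ℕ) :
    (x + y) ^ (2 * m) + (x - y) ^ (2 * m)
      = 2 * ∑ j ∈ range (m + 1), ((2 * m).choose (2 * j) : ℝ) * (x ^ 2) ^ j * (y ^ 2) ^ (m - j) := by
  rw [sub_eq_add_neg, add_pow, add_pow, ← sum_add_distrib, sum_range_two_mul_add_one, mul_sum]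
  rw [sum_eq_zero (s := range m), add_zero]
  · refine sum_congr rfl fun j hj => ?_
    have hj : j ≤ m := by simpa [Nat.lt_succ_iff] using hj
    rw [show 2 * m - 2 * j = 2 * (m - j) by omega]
    simp only [pow_mul, neg_sq]
    ring
  · intro j hj
    have hj : j < m := by simpa using hj
    have : Odd (2 * m - (2 * j + 1)) := ⟨m - j - 1, by omega⟩
    rw [this.neg_pow]
    ring

/-- Khintchine's inequality for even moments, with the Gaussian constant. -/
lemma khintchine_even {κ : Type*} [Fintype κ] [DecidableEq κ] (a : κ → ℝ) (J : Finset κ) (m : ℕ) :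
    ∑ z : κ → Bool, (∑ j ∈ J, boolSign (z j) * a j) ^ (2 * m)
      ≤ Fintype.card (κ → Bool) * (gaussMoment m * (∑ j ∈ J, a j ^ 2) ^ m) := by
  induction J using Finset.induction_on generalizing m with
  | empty =>
    rcases Nat.eq_zero_or_pos m with rfl | hm
    · simp [gaussMoment]
    · simp [hm.ne']
  | insert i J hi ih =>
    set S : (κ → Bool) → ℝ := fun z => ∑ j ∈ J, boolSign (z j) * a j with hS
    let flip : (κ → Bool) → (κ → Bool) := fun z => Function.update z i (!z i)
    have hflip : Function.Involutive flip := fun z => by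
      ext j; by_cases h : j = i <;> simp [flip, h]
    have hSflip : ∀ z, S (flip z) = S z := fun z => by
      refine sum_congr rfl fun j hj => ?_
      have : j ≠ i := by rintro rfl; exact hi hj
      simp [flip, this]
    have e1 : ∑ z : κ → Bool, (boolSign (z i) * a i + S z) ^ (2 * m)
        = ∑ z : κ → Bool, (S z - boolSign (z i) * a i) ^ (2 * m) := by
      rw [← Equiv.sum_comp (hflip.toPerm flip)]
      refine sum_congr rfl fun z _ => ?_
      rw [Function.Involutive.coe_toPerm, hSflip]
      simp only [flip, Function.update_self, boolSign_not]
      ring_nf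
    have e2 : 2 * ∑ z : κ → Bool, (boolSign (z i) * a i + S z) ^ (2 * m)
        = 2 * ∑ j ∈ range (m + 1), ((2 * m).choose (2 * j) : ℝ) * (a i ^ 2) ^ (m - j)
            * ∑ z, S z ^ (2 * j) := by
      rw [two_mul]
      nth_rewrite 2 [e1]
      rw [← sum_add_distrib, mul_sum]
      simp_rw [mul_sum]
      rw [sum_comm]
      refine sum_congr rfl fun z _ => ?_
      rw [add_comm (boolSign (z i) * a i), add_pow_add_sub_pow, mul_sum]
      refine sum_congr rfl fun j _ => ?_
      rw [mul_pow (boolSign _), boolSign_sq, one_mul, pow_mul]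
      ring
    simp_rw [sum_insert hi]
    rw [mul_left_cancel₀ two_ne_zero e2, add_comm (a i ^ 2), add_pow, mul_sum, mul_sum]
    refine sum_le_sum fun j hj => ?_
    have hj : j ≤ m := by simpa [Nat.lt_succ_iff] using hj
    have hσ : 0 ≤ ∑ j ∈ J, a j ^ 2 := sum_nonneg fun _ _ => sq_nonneg _
    calc _ ≤ ((2 * m).choose (2 * j) : ℝ) * (a i ^ 2) ^ (m - j)
            * (Fintype.card (κ → Bool) * (gaussMoment j * (∑ j ∈ J, a j ^ 2) ^ j)) := by
          gcongr
          exact ih j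
      _ = (Fintype.card (κ → Bool) * (∑ j ∈ J, a j ^ 2) ^ j * (a i ^ 2) ^ (m - j))
            * (((2 * m).choose (2 * j) : ℝ) * gaussMoment j) := by ring
      _ ≤ (Fintype.card (κ → Bool) * (∑ j ∈ J, a j ^ 2) ^ j * (a i ^ 2) ^ (m - j))
            * (gaussMoment m * m.choose j) := by
          exact mul_le_mul_of_nonneg_left (choose_mul_gaussMoment_le hj) (by positivity)
      _ = _ := by ring

/-- A form of Minkowski's inequality for `m`-th moments. -/
lemma sum_pow_sum_le {Ω κ : Type*} [Fintype Ω] [Fintype κ] (F : κ → Ω → ℝ) (w : κ → ℝ) (C : ℝ)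
    (m : ℕ) (hm : m ≠ 0) (hF : ∀ j y, 0 ≤ F j y) (hw : ∀ j, 0 ≤ w j)
    (h : ∀ j, ∑ y, F j y ^ m ≤ C * w j ^ m) :
    ∑ y, (∑ j, F j y) ^ m ≤ C * (∑ j, w j) ^ m := by
  have hzero : ∀ j, w j = 0 → ∀ y, F j y = 0 := by
    intro j hj y
    have h0 := h j
    rw [hj, zero_pow hm, mul_zero] at h0
    have := (sum_eq_zero_iff_of_nonneg (fun y _ => pow_nonneg (hF j y) m)).1
      (le_antisymm h0 (sum_nonneg fun y _ => pow_nonneg (hF j y) m)) y (mem_univ y)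
    exact pow_eq_zero_iff hm |>.1 this
  rcases (sum_nonneg fun j _ => hw j : 0 ≤ ∑ j, w j).eq_or_lt with hW | hW
  · have : ∀ j, w j = 0 := fun j =>
      (sum_eq_zero_iff_of_nonneg (fun j _ => hw j)).1 hW.symm j (mem_univ j)
    simp [this, fun j => hzero j (this j), hm]
  · set W := ∑ j, w j with hWdef
    have jensen : ∀ y, (∑ j, F j y) ^ m ≤ W ^ m * ∑ j, w j / W * (F j y / w j) ^ m := by
      intro y
      have := Real.pow_arith_mean_le_arith_mean_pow univ (fun j => w j / W)
        (fun j => F j y / w j) (fun j _ => div_nonneg (hw j) hW.le)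
        (by rw [← sum_div, div_self hW.ne']) (fun j _ => div_nonneg (hF j y) (hw j)) m
      calc (∑ j, F j y) ^ m = W ^ m * (∑ j, w j / W * (F j y / w j)) ^ m := by
            rw [← mul_pow, mul_sum]
            congr 1
            refine sum_congr rfl fun j _ => ?_
            by_cases hj : w j = 0
            · simp [hj, hzero j hj y]
            · field_simp
        _ ≤ _ := by gcongr
    calc ∑ y, (∑ j, F j y) ^ m ≤ ∑ y, W ^ m * ∑ j, w j / W * (F j y / w j) ^ m :=
          sum_le_sum fun y _ => jensen y
      _ = W ^ m * ∑ j, w j / W * ((∑ y, F j y ^ m) / w j ^ m) := by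
          rw [← mul_sum, sum_comm]
          congr 1
          refine sum_congr rfl fun j _ => ?_
          rw [← mul_sum, sum_div]
          simp_rw [div_pow]
      _ ≤ W ^ m * ∑ j, w j / W * C := by
          refine mul_le_mul_of_nonneg_left (sum_le_sum fun j _ => ?_) (by positivity)
          by_cases hj : w j = 0
          · simp [hj]
          · refine mul_le_mul_of_nonneg_left ?_ (div_nonneg (hw j) hW.le)
            have : 0 < w j := lt_of_le_of_ne (hw j) (Ne.symm hj)
            rw [div_le_iff₀ (by positivity)]
            exact h j
      _ = C * W ^ m := by
          rw [← sum_mul, ← sum_div, div_self hW.ne']; ring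

section Chaos

variable {ι κ : Type*} [Fintype ι] [DecidableEq ι] [Fintype κ]

/-- The average of the character `χ_I(y_x)` over `x`, with weights `p`. -/
noncomputable def charSum (I : Finset ι) (p : (ι → κ) → ℝ) (y : ι → κ → Bool) : ℝ :=
  ∑ x, p x * ∏ i ∈ I, boolSign (y i (x i))

lemma charSum_update {I : Finset ι} {i : ι} (hi : i ∉ I) (p : (ι → κ) → ℝ) (y : ι → κ → Bool)
    (u : κ → Bool) : charSum I p (Function.update y i u) = charSum I p y := by
  unfold charSum
  refine sum_congr rfl fun x _ => ?_
  congr 1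
  refine prod_congr rfl fun i' hi' => ?_
  rw [Function.update_of_ne (by rintro rfl; exact hi hi')]

variable [DecidableEq κ]

/-- The total weight of pairs agreeing on `I`: the squared `L²` norm of `charSum I p`. -/
noncomputable def collision (I : Finset ι) (p : (ι → κ) → ℝ) : ℝ :=
  ∑ x, p x * ∑ x' ∈ univ.filter (fun x' => ∀ i ∈ I, x' i = x i), p x'

lemma collision_nonneg (I : Finset ι) {p : (ι → κ) → ℝ} (hp : ∀ x, 0 ≤ p x) :
    0 ≤ collision I p :=
  sum_nonneg fun x _ => mul_nonneg (hp x) (sum_nonneg fun x' _ => hp x')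

lemma charSum_insert {I : Finset ι} {i : ι} (hi : i ∉ I) (p : (ι → κ) → ℝ) (y : ι → κ → Bool) :
    charSum (insert i I) p y
      = ∑ j, boolSign (y i j) * charSum I (fun x => if x i = j then p x else 0) y := by
  unfold charSum
  simp_rw [mul_sum]
  rw [sum_comm]
  refine sum_congr rfl fun x _ => ?_
  rw [sum_eq_single (x i) (fun j _ hj => by simp [hj.symm]) (by simp), prod_insert hi]
  simp only [if_true]
  ring

lemma collision_insert {I : Finset ι} {i : ι} (p : (ι → κ) → ℝ) :
    collision (insert i I) p = ∑ j, collision I (fun x => if x i = j then p x else 0) := by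
  unfold collision
  rw [sum_comm]
  refine sum_congr rfl fun x _ => ?_
  rw [sum_eq_single (x i) (fun j _ hj => by simp [hj.symm]) (by simp)]
  simp only [if_true]
  congr 1
  rw [← sum_filter, filter_filter]
  refine sum_congr ?_ fun _ _ => rfl
  ext x'
  simp [and_comm]

/-- Hypercontractivity for `charSum`, in even moments. -/
lemma sum_charSum_pow_le (I : Finset ι) (p : (ι → κ) → ℝ) (hp : ∀ x, 0 ≤ p x) (m : ℕ)
    (hm : m ≠ 0) :
    ∑ y, charSum I p y ^ (2 * m)
      ≤ Fintype.card (ι → κ → Bool) * gaussMoment m ^ #I * collision I p ^ m := by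
  induction I using Finset.induction_on generalizing p with
  | empty =>
    have : collision (∅ : Finset ι) p = (∑ x, p x) ^ 2 := by
      simp [collision, ← sum_mul, sq]
    simp [this, charSum, pow_mul]
  | insert i I hi ih =>
    set f : κ → (ι → κ → Bool) → ℝ :=
      fun j y => charSum I (fun x => if x i = j then p x else 0) y with hf
    have hp' : ∀ j x, 0 ≤ (if x i = j then p x else 0) := fun j x => by
      split_ifs; exacts [hp x, le_rfl]
    let shift : (κ → Bool) → (ι → κ → Bool) → (ι → κ → Bool) :=
      fun z y => Function.update y i (fun j => xor (y i j) (z j))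
    have hshift : ∀ z, Function.Involutive (shift z) := fun z y => by
      ext i' j
      by_cases h : i' = i
      · subst h; simp [shift]
      · simp [shift, h]
    have e : ∀ z : κ → Bool, ∑ y, charSum (insert i I) p y ^ (2 * m)
        = ∑ y, (∑ j, boolSign (z j) * (boolSign (y i j) * f j y)) ^ (2 * m) := fun z => by
      rw [← Equiv.sum_comp ((hshift z).toPerm (shift z))]
      refine sum_congr rfl fun y _ => ?_
      rw [Function.Involutive.coe_toPerm, charSum_insert hi]
      congr 1
      refine sum_congr rfl fun j _ => ?_
      rw [hf, ← mul_assoc, charSum_update hi]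
      simp [shift, boolSign_xor]
    have hN : (0 : ℝ) < Fintype.card (κ → Bool) := by exact_mod_cast Fintype.card_pos
    have e2 : Fintype.card (κ → Bool) * ∑ y, charSum (insert i I) p y ^ (2 * m)
        ≤ Fintype.card (κ → Bool) * (gaussMoment m * ∑ y, (∑ j, f j y ^ 2) ^ m) := by
      calc _ = ∑ z : κ → Bool, ∑ y, charSum (insert i I) p y ^ (2 * m) := by simp
        _ = ∑ y, ∑ z : κ → Bool,
              (∑ j, boolSign (z j) * (boolSign (y i j) * f j y)) ^ (2 * m) := by
            rw [sum_comm (s := univ (α := ι → κ → Bool))]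
            exact sum_congr rfl fun z _ => e z
        _ ≤ ∑ y, Fintype.card (κ → Bool) * (gaussMoment m *
              (∑ j, (boolSign (y i j) * f j y) ^ 2) ^ m) :=
            sum_le_sum fun y _ => khintchine_even _ _ _
        _ = _ := by
            simp_rw [mul_pow (boolSign _), boolSign_sq, one_mul, ← mul_sum]
    have e3 := sum_pow_sum_le (fun j y => f j y ^ 2)
      (fun j => collision I (fun x => if x i = j then p x else 0))
      (Fintype.card (ι → κ → Bool) * gaussMoment m ^ #I) m hm (fun _ _ => sq_nonneg _)
      (fun j => collision_nonneg I (hp' j))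
      (fun j => by simpa only [← pow_mul] using ih _ (hp' j))
    calc _ ≤ gaussMoment m * ∑ y, (∑ j, f j y ^ 2) ^ m := le_of_mul_le_mul_left e2 hN
      _ ≤ gaussMoment m * _ := mul_le_mul_of_nonneg_left e3 (gaussMoment_pos m).le
      _ = _ := by rw [← collision_insert, card_insert_of_notMem hi]; ring

/-- Since `charSum I p` is symmetric, its mean under a distribution of density at most `D`
is controlled by half of its absolute moments. -/
lemma abs_sum_mul_charSum_pow_le {I : Finset ι} (hI : I.Nonempty) (p : (ι → κ) → ℝ)
    (q : (ι → κ → Bool) → ℝ) (hq0 : ∀ y, 0 ≤ q y) (hq1 : ∑ y, q y = 1) (D : ℝ)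
    (hD : ∀ y, q y ≤ D) (r : ℕ) (hr : r ≠ 0) :
    |∑ y, q y * charSum I p y| ^ r ≤ D / 2 * ∑ y, |charSum I p y| ^ r := by
  obtain ⟨i, hi⟩ := hI
  let neg : (ι → κ → Bool) → (ι → κ → Bool) := fun y => Function.update y i (fun j => !y i j)
  have hneg : Function.Involutive neg := fun y => by
    ext i' j
    by_cases h : i' = i
    · subst h; simp [neg]
    · simp [neg, h]
  have hodd : ∀ y, charSum I p (neg y) = -charSum I p y := fun y => by
    unfold charSum
    rw [← sum_neg_distrib]
    refine sum_congr rfl fun x _ => ?_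
    rw [← mul_prod_erase _ _ hi, ← mul_prod_erase _ _ hi]
    have : ∏ i' ∈ I.erase i, boolSign (neg y i' (x i'))
        = ∏ i' ∈ I.erase i, boolSign (y i' (x i')) :=
      prod_congr rfl fun i' hi' => by simp [neg, ne_of_mem_erase hi']
    rw [this]
    simp [neg, boolSign_not]
  have hsym : ∑ y, max (-charSum I p y) 0 ^ r = ∑ y, max (charSum I p y) 0 ^ r := by
    rw [← Equiv.sum_comp (hneg.toPerm neg)]
    simp [hodd]
  have habs : ∑ y, |charSum I p y| ^ r = 2 * ∑ y, max (charSum I p y) 0 ^ r := by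
    rw [two_mul]
    nth_rewrite 2 [← hsym]
    rw [← sum_add_distrib]
    refine sum_congr rfl fun y _ => ?_
    rcases le_total 0 (charSum I p y) with h | h
    · simp [abs_of_nonneg h, h, hr]
    · simp [abs_of_nonpos h, h, hr]
  have hmax : ∀ g : (ι → κ → Bool) → ℝ,
      (∑ y, q y * max (g y) 0) ^ r ≤ D * ∑ y, max (g y) 0 ^ r := fun g => by
    calc _ ≤ ∑ y, q y * max (g y) 0 ^ r :=
          Real.pow_arith_mean_le_arith_mean_pow univ q _ (fun y _ => hq0 y) hq1
            (fun y _ => le_max_right _ _) r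
      _ ≤ ∑ y, D * max (g y) 0 ^ r := by
          gcongr with y
          exact hD y
      _ = _ := by rw [mul_sum]
  have hle : ∀ g : (ι → κ → Bool) → ℝ, ∑ y, q y * g y ≤ ∑ y, q y * max (g y) 0 := fun g =>
    sum_le_sum fun y _ => mul_le_mul_of_nonneg_left (le_max_left _ _) (hq0 y)
  rw [habs, show D / 2 * (2 * ∑ y, max (charSum I p y) 0 ^ r)
    = D * ∑ y, max (charSum I p y) 0 ^ r by ring]
  rcases abs_cases (∑ y, q y * charSum I p y) with ⟨h, h0⟩ | ⟨h, h0⟩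
  · rw [h]
    exact (pow_le_pow_left₀ h0 (hle _) r).trans (hmax _)
  · rw [h, ← hsym]
    refine (pow_le_pow_left₀ (by linarith) ?_ r).trans (hmax _)
    simpa using hle fun y => -charSum I p y

end Chaos

lemma two_rpow_le_one_add {u : ℝ} (h0 : 0 ≤ u) (h1 : u ≤ 1) : (2 : ℝ) ^ u ≤ 1 + u := by
  have := rpow_one_add_le_one_add_mul_self (s := 1) (by norm_num) h0 h1
  norm_num at this
  linarith

lemma two_rpow_mul_natCast (u : ℝ) (n : ℕ) : (2 : ℝ) ^ (u * n) = (2 ^ u) ^ n := by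
  rw [Real.rpow_mul zero_le_two, Real.rpow_natCast]

/-- The numerical optimisation over moments for a single block. -/
lemma le_half_of_moments {B s : ℝ} (hB : 0 ≤ B) (hs : 0 ≤ s) (h1 : B ≤ 2 ^ (s - 1))
    (h : ∀ m : ℕ, m ≠ 0 → B ^ (2 * m) ≤ 2 ^ (s - 1) * (m : ℝ) ^ m) : B ≤ (1 + s) / 2 := by
  have hpos : 0 ≤ (1 + s) / 2 := by positivity
  rcases le_total s 1 with hs1 | hs1
  · have := two_rpow_le_one_add hs hs1
    rw [Real.rpow_sub_one two_ne_zero] at h1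
    linarith
  rcases le_total s 3 with hs3 | hs3
  · rw [← pow_le_pow_iff_left₀ hB hpos two_ne_zero]
    have hv := two_rpow_le_one_add (u := (s - 1) / 2) (by linarith) (by linarith)
    calc B ^ 2 ≤ 2 ^ (s - 1) := by simpa using h 1 one_ne_zero
      _ = (2 ^ ((s - 1) / 2)) ^ 2 := by
          rw [← two_rpow_mul_natCast]; congr 1; push_cast; ring
      _ ≤ (1 + (s - 1) / 2) ^ 2 := by gcongr
      _ = _ := by ring
  rcases le_total s 7 with hs7 | hs7
  · rw [← pow_le_pow_iff_left₀ hB hpos four_ne_zero]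
    have hv := two_rpow_le_one_add (u := (s - 3) / 4) (by linarith) (by linarith)
    calc B ^ 4 ≤ 2 ^ (s - 1) * (2 : ℕ) ^ 2 := h 2 two_ne_zero
      _ = (2 ^ ((s - 3) / 4)) ^ 4 * 16 := by
          rw [← two_rpow_mul_natCast, show s - 1 = (s - 3) / 4 * (4 : ℕ) + (2 : ℕ) by
            push_cast; ring, Real.rpow_add_natCast two_ne_zero]
          push_cast; ring
      _ ≤ (1 + (s - 3) / 4) ^ 4 * 16 := by gcongr
      _ = _ := by ring
  · set m := ⌊(s + 1) / 2⌋₊ with hm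
    have hm4 : 4 ≤ m := Nat.le_floor (by push_cast; linarith)
    have hm1 : (m : ℝ) ≤ (s + 1) / 2 := Nat.floor_le (by linarith)
    have hm2 : (s + 1) / 2 < m + 1 := Nat.lt_floor_add_one _
    refine le_trans ?_ (hm1.trans_eq (by ring))
    rw [← pow_le_pow_iff_left₀ hB (Nat.cast_nonneg m) (show 2 * m ≠ 0 by omega)]
    calc B ^ (2 * m) ≤ 2 ^ (s - 1) * (m : ℝ) ^ m := h m (by omega)
      _ ≤ 2 ^ ((2 : ℝ) * m) * (m : ℝ) ^ m := by
          gcongr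
          · norm_num
          · linarith
      _ = 4 ^ m * (m : ℝ) ^ m := by
          rw [two_rpow_mul_natCast]; norm_num
      _ ≤ (m : ℝ) ^ m * (m : ℝ) ^ m := by
          gcongr
          exact_mod_cast hm4
      _ = _ := by rw [two_mul, pow_add]

/-- The numerical optimisation over moments for several blocks. -/
lemma le_pow_of_moments {B s : ℝ} {d : ℕ} (hB : 0 ≤ B) (hd : 2 ≤ d) (hs : 0 ≤ s)
    (h : ∀ m : ℕ, m ≠ 0 → B ^ (2 * m) ≤ 2 ^ (s - 1) * ((m : ℝ) ^ m) ^ d) :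
    B ≤ ((d + s) / 2) ^ d := by
  have hd0 : (0 : ℝ) < d := by exact_mod_cast (by omega : 0 < d)
  have hd2 : (2 : ℝ) ≤ d := by exact_mod_cast hd
  obtain ⟨t, rfl⟩ : ∃ t, s = t * d := ⟨s / d, by field_simp⟩
  have ht : 0 ≤ t := nonneg_of_mul_nonneg_left hs hd0
  have hbase : 1 + t ≤ (d + t * d) / 2 := by nlinarith
  suffices B ≤ (1 + t) ^ d from this.trans (by gcongr)
  have hexp : (2 : ℝ) ^ (t * d - 1) ≤ (2 ^ t) ^ d := by
    rw [← two_rpow_mul_natCast]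
    exact Real.rpow_le_rpow_of_exponent_le one_le_two (by linarith)
  rcases le_or_gt t 1 with ht1 | ht1
  · rw [← pow_le_pow_iff_left₀ hB (by positivity) two_ne_zero]
    calc B ^ 2 ≤ 2 ^ (t * d - 1) := by simpa using h 1 one_ne_zero
      _ ≤ (2 ^ t) ^ d := hexp
      _ ≤ (1 + t) ^ d := by
          gcongr
          exact two_rpow_le_one_add ht ht1
      _ ≤ ((1 + t) ^ d) ^ 2 := le_self_pow₀ (one_le_pow₀ (by linarith)) two_ne_zero
  set m := ⌈t⌉₊ with hm
  have hm2 : 2 ≤ m := Nat.lt_ceil.2 (by exact_mod_cast ht1)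
  have hm1 : t ≤ m := Nat.le_ceil t
  have hm3 : (m : ℝ) < t + 1 := Nat.ceil_lt_add_one ht
  suffices B ≤ (m : ℝ) ^ d from this.trans (by gcongr; linarith)
  rw [← pow_le_pow_iff_left₀ hB (by positivity) (show 2 * m ≠ 0 by omega)]
  calc B ^ (2 * m) ≤ 2 ^ (t * d - 1) * ((m : ℝ) ^ m) ^ d := h m (by omega)
    _ ≤ (2 ^ t) ^ d * ((m : ℝ) ^ m) ^ d := by gcongr
    _ ≤ (2 ^ (m : ℝ)) ^ d * ((m : ℝ) ^ m) ^ d := by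
        gcongr
        norm_num
    _ = (2 ^ m) ^ d * ((m : ℝ) ^ m) ^ d := by rw [Real.rpow_natCast]
    _ ≤ ((m : ℝ) ^ m) ^ d * ((m : ℝ) ^ m) ^ d := by
        gcongr
        exact_mod_cast hm2
    _ = _ := by rw [← mul_pow, ← pow_add, ← two_mul, ← pow_mul, ← pow_mul, mul_comm]

/-- Lemma A.1, Fourier lemma.
`p` is the distribution of the random variable `Λ` on `[ℓ]^k`, and `q` is the
distribution of the random variable `Γ` on `({-1,+1}^ℓ)^k`, where a vector in
`{-1,+1}^ℓ` is encoded as a function `Fin ℓ → Bool` with `b ↦ (-1)^b`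
(i.e. `true ↦ -1`, `false ↦ +1`).
If `Λ` has blockwise min-entropy at least `β > 1/2` and `Γ` has deficiency at
most `s ≥ 0` (i.e. `Pr[Γ = y] ≤ 2^(s - ℓk)` for all `y`), then for every
`I ⊆ [k]`, sampling `x ∼ Λ` and `y ∼ Γ` independently,
`|E[∏_{i ∈ I} y_i(x_i)]| ≤ (2^(-β/2 - 1) · (k + s))^|I|`. -/
theorem statement0 (ℓ k : ℕ) (hℓ : 1 ≤ ℓ) (hk : 1 ≤ k) (β s : ℝ)
    (hβ : 1 / 2 < β) (hs : 0 ≤ s)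
    (p : (Fin k → Fin ℓ) → ℝ) (q : (Fin k → Fin ℓ → Bool) → ℝ)
    (hp0 : ∀ x, 0 ≤ p x) (hp1 : ∑ x, p x = 1)
    (hq0 : ∀ y, 0 ≤ q y) (hq1 : ∑ y, q y = 1)
    (hblock : ∀ S : Finset (Fin k), S.Nonempty → ∀ α : Fin k → Fin ℓ,
      ∑ x ∈ univ.filter (fun x => ∀ i ∈ S, x i = α i), p x
        ≤ (2 : ℝ) ^ (-(β * (S.card : ℝ))))
    (hdef : ∀ y, q y ≤ (2 : ℝ) ^ (s - (ℓ : ℝ) * (k : ℝ))) :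
    ∀ I : Finset (Fin k),
      |∑ x, ∑ y, p x * q y * ∏ i ∈ I, (if y i (x i) then (-1 : ℝ) else 1)|
        ≤ ((2 : ℝ) ^ (-β / 2 - 1) * ((k : ℝ) + s)) ^ I.card := by
  intro I
  have hE : ∑ x, ∑ y, p x * q y * ∏ i ∈ I, (if y i (x i) then (-1 : ℝ) else 1)
      = ∑ y, q y * charSum I p y := by
    rw [sum_comm]
    refine sum_congr rfl fun y _ => ?_
    rw [charSum, mul_sum]
    refine sum_congr rfl fun x _ => ?_
    simp only [boolSign]
    ring
  rw [hE]
  rcases I.eq_empty_or_nonempty with rfl | hI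
  · simp [charSum, hp1, hq1]
  set A := |∑ y, q y * charSum I p y| with hA
  set d := #I with hd
  set N : ℝ := ((Fintype.card (Fin k → Fin ℓ → Bool) : ℕ) : ℝ) with hN
  have hNpow : N = 2 ^ ((ℓ : ℝ) * k) := by
    rw [two_rpow_mul_natCast, Real.rpow_natCast]
    simp [hN]
  have hN0 : 0 < N := hNpow ▸ by positivity
  set σ : ℝ := 2 ^ (-β / 2 * d) with hσ
  have hσ0 : 0 < σ := by positivity
  have hcoll : collision I p ≤ σ ^ 2 := by
    have hσ2 : σ ^ 2 = 2 ^ (-(β * d)) := by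
      rw [hσ, ← two_rpow_mul_natCast]; congr 1; push_cast; ring
    calc collision I p ≤ ∑ x, p x * 2 ^ (-(β * d)) :=
          sum_le_sum fun x _ =>
            mul_le_mul_of_nonneg_left (le_of_eq_of_le (by congr!) (hblock I hI x)) (hp0 x)
      _ = σ ^ 2 := by rw [← sum_mul, hp1, one_mul, hσ2]
  have hmoment : ∀ m : ℕ, m ≠ 0 →
      ∑ y, charSum I p y ^ (2 * m) ≤ N * ((m : ℝ) ^ m) ^ d * σ ^ (2 * m) := fun m hm => by
    refine (sum_charSum_pow_le I p hp0 m hm).trans ?_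
    rw [pow_mul σ]
    have := collision_nonneg I hp0
    have := (gaussMoment_pos m).le
    gcongr
    exact gaussMoment_le m
  have hdens : (2 : ℝ) ^ (s - (ℓ : ℝ) * k) / 2 * N = 2 ^ (s - 1) := by
    rw [Real.rpow_sub two_pos, Real.rpow_sub_one two_ne_zero, ← hNpow]
    field_simp
  have hmean := abs_sum_mul_charSum_pow_le hI p q hq0 hq1 _ hdef
  have hB : ∀ m : ℕ, m ≠ 0 → (A / σ) ^ (2 * m) ≤ 2 ^ (s - 1) * ((m : ℝ) ^ m) ^ d := fun m hm => by
    rw [div_pow, div_le_iff₀ (by positivity)]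
    have h := hmean (2 * m) (by omega)
    simp_rw [(even_two_mul m).pow_abs] at h
    rw [hA, (even_two_mul m).pow_abs]
    calc _ ≤ _ := h
      _ ≤ 2 ^ (s - (ℓ : ℝ) * k) / 2 * (N * ((m : ℝ) ^ m) ^ d * σ ^ (2 * m)) := by
          gcongr
          exact hmoment m hm
      _ = _ := by rw [← hdens]; ring
  have hB1 : A / σ ≤ 2 ^ (s - 1) := by
    rw [div_le_iff₀ hσ0]
    have hL1 : ∑ y, |charSum I p y| ≤ N * σ := by
      refine abs_le_of_sq_le_sq' ?_ (by positivity) |>.2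
      have hcs := sq_sum_le_card_mul_sum_sq (s := univ) (f := fun y => |charSum I p y|)
      simp_rw [sq_abs] at hcs
      have h2 := hmoment 1 one_ne_zero
      calc _ ≤ N * ∑ y, charSum I p y ^ 2 := by simpa only [card_univ] using hcs
        _ ≤ N * (N * σ ^ 2) := by
            gcongr
            simpa using h2
        _ = _ := by ring
    have h := hmean 1 one_ne_zero
    simp only [pow_one] at h
    calc A ≤ _ := h
      _ ≤ 2 ^ (s - (ℓ : ℝ) * k) / 2 * (N * σ) := by gcongr
      _ = _ := by rw [← hdens]; ring
  have hB0 : 0 ≤ A / σ := div_nonneg (abs_nonneg _) hσ0.le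
  have hdk : (d : ℝ) ≤ k := by
    exact_mod_cast (card_le_univ I).trans_eq (Fintype.card_fin k)
  have hmain : A / σ ≤ ((d + s) / 2) ^ d := by
    have hd1 : 1 ≤ d := hI.card_pos
    rcases hd1.eq_or_lt with h1 | h1
    · rw [← h1] at hB ⊢
      simpa using le_half_of_moments hB0 hs hB1 (by simpa using hB)
    · exact le_pow_of_moments hB0 h1 hs hB
  rw [div_le_iff₀ hσ0] at hmain
  calc A ≤ ((d + s) / 2) ^ d * σ := hmain
    _ ≤ ((k + s) / 2) ^ d * σ := by gcongr
    _ = _ := by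
        rw [hσ, two_rpow_mul_natCast, ← mul_pow, Real.rpow_sub_one two_ne_zero]
        congr 1
        ring
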